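/- Consider the symmetric Bernoulli displacement model (p = 1/2) with λ > 0 and let E_− = E_−(λ) = λ/2 − √(2 + λ²/4 + √(4+λ²)). Then there exist constants C > 0 and ε > 0 such that for all E ∈ (E_−, E_− + ε), liminf_{L→∞} (1/(2L)) 𝔼[ #{k : E_k(h^D_{Λ(L)}(ω)) ≤ E} ] ≥ C / (log(E − E_−))². In particular the integrated density of states N_λ satisfies N_λ(E) − N_λ(E_−) ≥ C/log²(E−E_−) near E_−, so N_λ is not Hölder continuous at E_−. -/

import Mathlib

open scoped BigOperators ENNReal
open MeasureTheory Filter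

noncomputable section

/-- The set of nearest neighbors of a point of `ℤ`. -/
def nbhd1 (n : ℤ) : Finset ℤ := {n - 1, n + 1}

/-- `n_S(i)`: the number of nearest neighbors of `i` lying outside `S ⊂ ℤ`. -/
def nOut1 (S : Finset ℤ) (i : ℤ) : ℕ :=
  ((nbhd1 i).filter fun j => j ∉ S).card

/-- The Dirichlet restriction `h^D_S = h_{0,S} + N_S + V` on the finite set `S ⊂ ℤ`. -/
def dirMat (S : Finset ℤ) (V : ℤ → ℝ) : Matrix S S ℝ :=
  fun i j => (if |(i : ℤ) - (j : ℤ)| = 1 then (-1 : ℝ) else 0)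
    + (if i = j then (V (i : ℤ) + (nOut1 S (i : ℤ) : ℝ)) else 0)

/-- The number of eigenvalues (counted with multiplicity, i.e. roots of the
characteristic polynomial) that are `≤ E`. -/
def countLE {n : Type*} [Fintype n] [DecidableEq n] (A : Matrix n n ℝ) (E : ℝ) : ℕ :=
  (A.charpoly.roots.filter (fun x => x ≤ E)).card

open Classical in
/-- The potential of the Bernoulli displacement model. -/
def Vbdm (lam : ℝ) (ω : ℤ → ℤ) (n : ℤ) : ℝ :=
  if ∃ k : ℤ, n = 2 * k + 1 + ω k then lam else 0

theorem card_le_countLE {n ι : Type*} [Fintype n] [DecidableEq n] [Fintype ι]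
    {A : Matrix n n ℝ} (hA : A.IsHermitian) {E : ℝ} (v : ι → n → ℝ) (hv : ∀ i, v i ≠ 0)
    (horth : ∀ i j, i ≠ j → v i ⬝ᵥ v j = 0)
    (hAorth : ∀ i j, i ≠ j → v i ⬝ᵥ A.mulVec (v j) = 0)
    (hle : ∀ i, v i ⬝ᵥ A.mulVec (v i) ≤ E * (v i ⬝ᵥ v i)) :
    Fintype.card ι ≤ countLE A E := by
  classical
  have hcount : countLE A E = Fintype.card {i // hA.eigenvalues i ≤ E} := by
    rw [countLE, hA.roots_charpoly_eq_eigenvalues, Multiset.filter_map, Multiset.card_map,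
      Fintype.card_subtype]
    rfl
  let b : n → n → ℝ := fun i => (hA.eigenvectorBasis i).ofLp
  have hpars : ∀ x y : n → ℝ, x ⬝ᵥ y = ∑ i, (b i ⬝ᵥ x) * (b i ⬝ᵥ y) := by
    intro x y
    have h := hA.eigenvectorBasis.sum_inner_mul_inner (WithLp.toLp 2 y) (WithLp.toLp 2 x)
    simp only [EuclideanSpace.inner_eq_star_dotProduct, star_trivial] at h
    rw [← h]
    refine Finset.sum_congr rfl fun i _ => ?_
    rw [mul_comm, dotProduct_comm (b i) x]
  have hbA : ∀ i (w : n → ℝ), b i ⬝ᵥ A.mulVec w = hA.eigenvalues i * (b i ⬝ᵥ w) := by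
    intro i w
    have hT : A.transpose = A := by simpa [Matrix.IsHermitian] using hA
    rw [Matrix.dotProduct_mulVec, ← Matrix.mulVec_transpose, hT]
    change (A.mulVec (hA.eigenvectorBasis i).ofLp) ⬝ᵥ w = _
    rw [hA.mulVec_eigenvectorBasis, smul_dotProduct]
    rfl
  let W : (ι → ℝ) →ₗ[ℝ] (n → ℝ) := Fintype.linearCombination ℝ v
  let T : (ι → ℝ) →ₗ[ℝ] ({i // hA.eigenvalues i ≤ E} → ℝ) :=
    LinearMap.pi fun i => (dotProductBilin ℝ ℝ (b i)).comp W
  have hW : ∀ c, W c = ∑ j, c j • v j := fun c => Fintype.linearCombination_apply ℝ v c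
  have hself : ∀ c j, v j ⬝ᵥ W c = c j * (v j ⬝ᵥ v j) := by
    intro c j
    rw [hW, dotProduct_sum, Finset.sum_eq_single j]
    · simp
    · intro i _ hij
      simp [horth j i hij.symm]
    · simp
  have hselfA : ∀ c j, v j ⬝ᵥ A.mulVec (W c) = c j * (v j ⬝ᵥ A.mulVec (v j)) := by
    intro c j
    rw [hW, Matrix.mulVec_sum, dotProduct_sum, Finset.sum_eq_single j]
    · simp [Matrix.mulVec_smul]
    · intro i _ hij
      simp [Matrix.mulVec_smul, hAorth j i hij.symm]
    · simp
  have hform : ∀ c, W c ⬝ᵥ A.mulVec (W c) ≤ E * (W c ⬝ᵥ W c) := by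
    intro c
    have h1 : ∀ y, W c ⬝ᵥ y = ∑ j, c j * (v j ⬝ᵥ y) := by
      intro y; rw [hW, sum_dotProduct]; simp
    rw [h1, h1, Finset.mul_sum]
    refine Finset.sum_le_sum fun j _ => ?_
    rw [hself, hselfA]
    nlinarith [mul_le_mul_of_nonneg_left (hle j) (mul_self_nonneg (c j))]
  have hinj : Function.Injective T := by
    rw [← LinearMap.ker_eq_bot, LinearMap.ker_eq_bot']
    intro c hc
    have hlow : ∀ i, hA.eigenvalues i ≤ E → b i ⬝ᵥ W c = 0 := fun i hi => by
      simpa [T, dotProductBilin] using congrFun hc ⟨i, hi⟩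
    have hf := hform c
    rw [hpars (W c) (A.mulVec (W c)), hpars (W c) (W c), Finset.mul_sum, ← sub_nonneg,
      ← Finset.sum_sub_distrib] at hf
    have hnonpos : ∀ i ∈ Finset.univ, E * ((b i ⬝ᵥ W c) * (b i ⬝ᵥ W c)) -
        (b i ⬝ᵥ W c) * (b i ⬝ᵥ A.mulVec (W c)) ≤ 0 := by
      intro i _
      rw [hbA]
      rcases le_or_gt (hA.eigenvalues i) E with h | h
      · simp [hlow i h]
      · nlinarith [mul_self_nonneg (b i ⬝ᵥ W c)]
    have hz := (Finset.sum_eq_zero_iff_of_nonpos hnonpos).1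
      (le_antisymm (Finset.sum_nonpos hnonpos) hf)
    have hall : ∀ i, b i ⬝ᵥ W c = 0 := by
      intro i
      rcases le_or_gt (hA.eigenvalues i) E with h | h
      · exact hlow i h
      · have := hz i (Finset.mem_univ i)
        rw [hbA] at this
        have h2 : (E - hA.eigenvalues i) * ((b i ⬝ᵥ W c) * (b i ⬝ᵥ W c)) = 0 := by linarith
        rcases mul_eq_zero.1 h2 with h3 | h3
        · linarith
        · exact mul_self_eq_zero.1 h3
    funext j
    have hj := hself c j
    rw [hpars (v j) (W c)] at hj
    simp only [hall, mul_zero, Finset.sum_const_zero] at hj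
    rcases mul_eq_zero.1 hj.symm with h | h
    · exact h
    · exact absurd (dotProduct_self_eq_zero.1 h) (hv j)
  have := LinearMap.finrank_le_finrank_of_injective hinj
  simpa [hcount] using this

theorem countLE_le_card {n : Type*} [Fintype n] [DecidableEq n] (A : Matrix n n ℝ) (E : ℝ) :
    countLE A E ≤ Fintype.card n :=
  (Multiset.card_le_card (Multiset.filter_le _ _)).trans
    ((Polynomial.card_roots' _).trans (Matrix.charpoly_natDegree_eq_dim A).le)

theorem Vbdm_odd (lam : ℝ) {ω : ℤ → ℤ} (hω : ∀ k, ω k = 0 ∨ ω k = 1) (k : ℤ) :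
    Vbdm lam ω (2 * k + 1) = if ω k = 0 then lam else 0 := by
  have : (∃ l : ℤ, 2 * k + 1 = 2 * l + 1 + ω l) ↔ ω k = 0 := by
    constructor
    · rintro ⟨l, hl⟩
      have hlk : l = k := by rcases hω l with h | h <;> omega
      subst hlk
      omega
    · intro h
      exact ⟨k, by omega⟩
  simp only [Vbdm, this]

theorem Vbdm_even (lam : ℝ) {ω : ℤ → ℤ} (hω : ∀ k, ω k = 0 ∨ ω k = 1) (k : ℤ) :
    Vbdm lam ω (2 * k + 2) = if ω k = 0 then 0 else lam := by
  have : (∃ l : ℤ, 2 * k + 2 = 2 * l + 1 + ω l) ↔ ¬ω k = 0 := by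
    constructor
    · rintro ⟨l, hl⟩
      have hlk : l = k := by rcases hω l with h | h <;> omega
      subst hlk
      omega
    · intro h
      exact ⟨k, by rcases hω k with h' | h' <;> omega⟩
  simp only [Vbdm, this, ite_not]

theorem dirMat_isHermitian (S : Finset ℤ) (V : ℤ → ℝ) : (dirMat S V).IsHermitian := by
  ext i j
  simp only [Matrix.conjTranspose_apply, star_trivial, dirMat, abs_sub_comm (j : ℤ) (i : ℤ),
    eq_comm (a := j) (b := i)]
  congr 1
  split_ifs with h
  · rw [h]
  · rfl

/-- On functions vanishing near the boundary, the Dirichlet restriction to `[1, N]` acts like the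
operator on the whole line. -/
theorem dirMat_mulVec_of_interior {N : ℤ} (V z : ℤ → ℝ) (hz : ∀ i, z i ≠ 0 → 2 ≤ i ∧ i ≤ N - 1)
    (i : Finset.Icc 1 N) :
    (dirMat (Finset.Icc 1 N) V).mulVec (fun j => z j) i =
      V i * z i - z (i - 1) - z (i + 1) := by
  have hz0 : ∀ i, ¬(2 ≤ i ∧ i ≤ N - 1) → z i = 0 := fun i h => by_contra fun h' => h (hz i h')
  have hi := Finset.mem_Icc.1 i.2
  have hN : (nOut1 (Finset.Icc 1 N) i : ℝ) * z i = 0 := by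
    by_cases h : z i = 0
    · simp [h]
    · have := hz i h
      have : nOut1 (Finset.Icc 1 N) i = 0 := by
        rw [nOut1, Finset.card_eq_zero, Finset.filter_eq_empty_iff]
        intro j hj
        simp only [nbhd1, Finset.mem_insert, Finset.mem_singleton] at hj
        simp only [Finset.mem_Icc, not_not]
        omega
      simp [this]
  have hoff : ∑ j : Finset.Icc 1 N, (if |(i : ℤ) - (j : ℤ)| = 1 then (-1 : ℝ) else 0) * z j =
      -z (i - 1) - z (i + 1) := by
    rw [Finset.sum_coe_sort (Finset.Icc 1 N)
      (fun j => (if |(i : ℤ) - j| = 1 then (-1 : ℝ) else 0) * z j)]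
    have : ∀ j ∈ Finset.Icc 1 N, (if |(i : ℤ) - j| = 1 then (-1 : ℝ) else 0) * z j =
        (if j = (i : ℤ) - 1 then -z j else 0) + (if j = (i : ℤ) + 1 then -z j else 0) := by
      intro j _
      by_cases h1 : j = (i : ℤ) - 1
      · subst h1; simp; omega
      · by_cases h2 : j = (i : ℤ) + 1
        · subst h2; simp; omega
        · have : ¬ |(i : ℤ) - j| = 1 := by
            intro h
            rcases (abs_eq (by norm_num)).1 h with h | h <;> omega
          simp [h1, h2, this]
    rw [Finset.sum_congr rfl this, Finset.sum_add_distrib, Finset.sum_ite_eq', Finset.sum_ite_eq']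
    have e1 : (if (i : ℤ) - 1 ∈ Finset.Icc 1 N then -z (i - 1) else 0) = -z (i - 1) := by
      split_ifs with h
      · rfl
      · rw [hz0 _ (by rw [Finset.mem_Icc] at h; omega), neg_zero]
    have e2 : (if (i : ℤ) + 1 ∈ Finset.Icc 1 N then -z (i + 1) else 0) = -z (i + 1) := by
      split_ifs with h
      · rfl
      · rw [hz0 _ (by rw [Finset.mem_Icc] at h; omega), neg_zero]
    rw [e1, e2]
    ring
  simp only [Matrix.mulVec, dotProduct, dirMat, add_mul, Finset.sum_add_distrib]
  rw [hoff]
  simp only [ite_mul, add_mul, zero_mul, Finset.sum_ite_eq, Finset.mem_univ, if_true, hN]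
  ring

/-- The function on sites that takes the value `G ⌊i / 2⌋` on the dimers `s, …, e - 1`. -/
def bump (G : ℤ → ℝ) (s e i : ℤ) : ℝ :=
  if 2 * s + 1 ≤ i ∧ i ≤ 2 * e then G (i / 2) else 0

/-- The values of the positive ground-state solution at the dimer boundaries: it grows by the factor `r`
across a dimer with `ω k = 0` and decays by the same factor otherwise. -/
def IsWeight (r : ℝ) (ω : ℤ → ℤ) (s e : ℤ) (G : ℤ → ℝ) : Prop :=
  ∀ k, s ≤ k → k < e → if ω k = 0 then G (k + 1) = r * G k else G k = r * G (k + 1)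

theorem bump_ne_zero {G : ℤ → ℝ} {s e i : ℤ} (h : bump G s e i ≠ 0) :
    2 * s + 1 ≤ i ∧ i ≤ 2 * e := by
  by_contra h'
  exact h (if_neg h')

theorem bump_mul_schrodinger {r lam : ℝ} (hr : 0 < r) (hlam : lam = r - 1 / r) {ω : ℤ → ℤ}
    (hω : ∀ k, ω k = 0 ∨ ω k = 1) {s e : ℤ} (G : ℤ → ℝ) (hG : IsWeight r ω s e G) (i : ℤ) :
    bump G s e i * (Vbdm lam ω i * bump G s e i - bump G s e (i - 1) - bump G s e (i + 1)) ≤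
      (-1 - 1 / r) * (bump G s e i * bump G s e i) +
        ((if i = 2 * s + 1 then G s ^ 2 else 0) + (if i = 2 * e then G e ^ 2 else 0)) := by
  by_cases hi : 2 * s + 1 ≤ i ∧ i ≤ 2 * e
  swap
  · have h0 : bump G s e i = 0 := if_neg hi
    rw [h0]
    have h1 : 0 ≤ (if i = 2 * s + 1 then G s ^ 2 else 0) := by split_ifs <;> positivity
    have h2 : 0 ≤ (if i = 2 * e then G e ^ 2 else 0) := by split_ifs <;> positivity
    simp only [zero_mul, mul_zero, zero_add]
    linarith
  apply le_of_eq
  obtain ⟨k, hk | hk⟩ : ∃ k, i = 2 * k + 1 ∨ i = 2 * k + 2 := ⟨(i - 1) / 2, by omega⟩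
  · subst hk
    have hsk : s ≤ k := by omega
    have hke : k < e := by omega
    have d0 : (2 * k + 1) / 2 = k := by omega
    have d1 : (2 * k + 1 - 1) / 2 = k := by omega
    have d2 : (2 * k + 1 + 1) / 2 = k + 1 := by omega
    have b0 : bump G s e (2 * k + 1) = G k := by rw [bump, if_pos hi, d0]
    have b1 : bump G s e (2 * k + 1 - 1) = if k = s then 0 else G k := by
      rw [bump, d1]; split_ifs <;> first | rfl | omega
    have b2 : bump G s e (2 * k + 1 + 1) = G (k + 1) := by rw [bump, if_pos (by omega), d2]
    have he : ¬ (2 * k + 1 = 2 * e) := by omega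
    have hs : (2 * k + 1 = 2 * s + 1) ↔ k = s := by omega
    rw [b0, b1, b2, Vbdm_odd lam hω, if_neg he]
    simp only [hs]
    have hw := hG k hsk hke
    by_cases h0 : ω k = 0
    · rw [if_pos h0] at hw ⊢
      rw [hw, hlam]
      split_ifs with h
      · subst h; field_simp; ring
      · field_simp; ring
    · rw [if_neg h0] at hw ⊢
      split_ifs with h
      · subst h; rw [hw]; field_simp; ring
      · rw [hw]; field_simp; ring
  · subst hk
    have hsk : s ≤ k := by omega
    have hke : k < e := by omega
    have d0 : (2 * k + 2) / 2 = k + 1 := by omega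
    have d1 : (2 * k + 2 - 1) / 2 = k := by omega
    have d2 : (2 * k + 2 + 1) / 2 = k + 1 := by omega
    have b0 : bump G s e (2 * k + 2) = G (k + 1) := by rw [bump, if_pos hi, d0]
    have b1 : bump G s e (2 * k + 2 - 1) = G k := by rw [bump, if_pos (by omega), d1]
    have b2 : bump G s e (2 * k + 2 + 1) = if k + 1 = e then 0 else G (k + 1) := by
      rw [bump, d2]; split_ifs <;> first | rfl | omega
    have hs : ¬ (2 * k + 2 = 2 * s + 1) := by omega
    have he : (2 * k + 2 = 2 * e) ↔ k + 1 = e := by omega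
    rw [b0, b1, b2, Vbdm_even lam hω, if_neg hs]
    simp only [he]
    have hw := hG k hsk hke
    by_cases h0 : ω k = 0
    · rw [if_pos h0] at hw ⊢
      split_ifs with h
      · subst h; rw [hw]; field_simp; ring
      · rw [hw]; field_simp; ring
    · rw [if_neg h0] at hw ⊢
      rw [hw, hlam]
      split_ifs with h
      · subst h; field_simp; ring
      · field_simp; ring

theorem bump_form_le {r lam : ℝ} (hr : 0 < r) (hlam : lam = r - 1 / r) {ω : ℤ → ℤ}
    (hω : ∀ k, ω k = 0 ∨ ω k = 1) {s e N : ℤ} (hs : 1 ≤ s) (he : 2 * e ≤ N - 1)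
    (G : ℤ → ℝ) (hG : IsWeight r ω s e G) :
    (fun j : Finset.Icc 1 N => bump G s e j) ⬝ᵥ
        (dirMat (Finset.Icc 1 N) (Vbdm lam ω)).mulVec (fun j => bump G s e j) ≤
      (-1 - 1 / r) * ((fun j : Finset.Icc 1 N => bump G s e j) ⬝ᵥ fun j => bump G s e j) +
        (G s ^ 2 + G e ^ 2) := by
  have hz : ∀ i, bump G s e i ≠ 0 → 2 ≤ i ∧ i ≤ N - 1 := fun i hi => by
    have := bump_ne_zero hi
    omega
  simp only [dotProduct, dirMat_mulVec_of_interior _ _ hz]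
  refine (Finset.sum_le_sum fun (i : Finset.Icc 1 N) _ =>
    bump_mul_schrodinger hr hlam hω G hG i).trans ?_
  rw [Finset.sum_add_distrib, Finset.mul_sum]
  gcongr
  rw [Finset.sum_coe_sort (Finset.Icc 1 N)
    (fun i => (if i = 2 * s + 1 then G s ^ 2 else 0) + (if i = 2 * e then G e ^ 2 else 0)),
    Finset.sum_add_distrib, Finset.sum_ite_eq', Finset.sum_ite_eq']
  gcongr <;> split_ifs <;> first | exact le_rfl | positivity

theorem sq_le_bump_dotProduct {G : ℤ → ℝ} {s e N k : ℤ} (hs : 1 ≤ s) (he : 2 * e ≤ N - 1)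
    (hk : s < k) (hke : k ≤ e) :
    G k ^ 2 ≤ (fun j : Finset.Icc 1 N => bump G s e j) ⬝ᵥ fun j => bump G s e j := by
  have hb : bump G s e (2 * k) = G k := by
    have : 2 * k / 2 = k := by omega
    rw [bump, if_pos (by omega), this]
  have hmem : 2 * k ∈ Finset.Icc 1 N := Finset.mem_Icc.2 (by omega)
  have := Finset.single_le_sum (f := fun j : Finset.Icc 1 N => bump G s e j * bump G s e j)
    (fun j _ => mul_self_nonneg _) (Finset.mem_univ ⟨2 * k, hmem⟩)
  simpa only [hb, dotProduct, sq] using this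

theorem bump_dotProduct_eq_zero {G G' : ℤ → ℝ} {s e s' e' N : ℤ} (h : e < s' ∨ e' < s) :
    ((fun j : Finset.Icc 1 N => bump G s e j) ⬝ᵥ fun j => bump G' s' e' j) = 0 := by
  refine Finset.sum_eq_zero fun j _ => ?_
  by_contra hne
  have h1 := bump_ne_zero (left_ne_zero_of_mul hne)
  have h2 := bump_ne_zero (right_ne_zero_of_mul hne)
  omega

theorem bump_form_eq_zero (V : ℤ → ℝ) {G G' : ℤ → ℝ} {s e s' e' N : ℤ} (hs : 1 ≤ s')
    (he : 2 * e' ≤ N - 1) (h : e < s' ∨ e' < s) :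
    (fun j : Finset.Icc 1 N => bump G s e j) ⬝ᵥ
      (dirMat (Finset.Icc 1 N) V).mulVec (fun j => bump G' s' e' j) = 0 := by
  have hz : ∀ i, bump G' s' e' i ≠ 0 → 2 ≤ i ∧ i ≤ N - 1 := fun i hi => by
    have := bump_ne_zero hi
    omega
  refine Finset.sum_eq_zero fun j _ => ?_
  rw [dirMat_mulVec_of_interior _ _ hz]
  change bump G s e j * _ = 0
  by_cases hne : bump G s e j = 0
  · rw [hne, zero_mul]
  have h1 := bump_ne_zero hne
  have h0 : ∀ i : ℤ, ¬(2 * s' + 1 ≤ i ∧ i ≤ 2 * e') → bump G' s' e' i = 0 := fun i hi => if_neg hi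
  rw [h0 j (by omega), h0 (j - 1) (by omega), h0 (j + 1) (by omega)]
  simp

/-- The random walk which steps up at the dimers with `ω k = 0` and down at the others. -/
def walk (ω : ℤ → ℤ) (a b : ℤ) : ℤ := ∑ k ∈ Finset.Ico a b, (1 - 2 * ω k)

theorem walk_self (ω : ℤ → ℤ) (a : ℤ) : walk ω a a = 0 := by simp [walk]

theorem walk_add (ω : ℤ → ℤ) {a b c : ℤ} (hab : a ≤ b) (hbc : b ≤ c) :
    walk ω a b + walk ω b c = walk ω a c := by
  rw [walk, walk, walk, ← Finset.Ico_union_Ico_eq_Ico hab hbc,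
    Finset.sum_union (Finset.Ico_disjoint_Ico_consecutive a b c)]

theorem isWeight_zpow_walk {r : ℝ} (hr : 0 < r) {ω : ℤ → ℤ} (hω : ∀ k, ω k = 0 ∨ ω k = 1)
    (s e : ℤ) : IsWeight r ω s e fun k => r ^ walk ω s k := by
  intro k hk _
  have hstep : walk ω s (k + 1) = walk ω s k + (1 - 2 * ω k) := by
    rw [← walk_add ω hk (by omega : k ≤ k + 1)]
    congr 1
    rw [walk, ← Finset.insert_Ico_right_eq_Ico_add_one le_rfl]
    simp
  rcases hω k with h | h
  · rw [if_pos h]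
    simp only [hstep, h]
    rw [zpow_add₀ hr.ne']; norm_num; ring
  · rw [if_neg (by omega)]
    simp only [hstep, h]
    rw [zpow_add₀ hr.ne']; norm_num; field_simp

theorem sum_powerset_insert_displacement {α : Type*} [DecidableEq α] {a : α} {s : Finset α}
    (ha : a ∉ s) (f : ℝ → ℝ) :
    ∑ t ∈ (insert a s).powerset, f (2 * (t.card : ℝ) - (insert a s).card) =
      ∑ t ∈ s.powerset, (f (2 * (t.card : ℝ) - s.card - 1) + f (2 * (t.card : ℝ) - s.card + 1)) := by
  rw [Finset.sum_powerset_insert ha, Finset.sum_add_distrib, Finset.card_insert_of_notMem ha]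
  congr 1
  · refine Finset.sum_congr rfl fun t _ => ?_
    push_cast
    congr 1
    ring
  · refine Finset.sum_congr rfl fun t ht => ?_
    rw [Finset.card_insert_of_notMem fun h => ha (Finset.mem_powerset.1 ht h)]
    push_cast
    congr 1
    ring

/-- The first four moments of the simple random walk, as sums over subsets. -/
theorem sum_powerset_displacement_pow {α : Type*} [DecidableEq α] (s : Finset α) :
    ∑ t ∈ s.powerset, (2 * (t.card : ℝ) - s.card) = 0 ∧
    ∑ t ∈ s.powerset, (2 * (t.card : ℝ) - s.card) ^ 2 = (s.card : ℝ) * 2 ^ s.card ∧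
    ∑ t ∈ s.powerset, (2 * (t.card : ℝ) - s.card) ^ 3 = 0 ∧
    ∑ t ∈ s.powerset, (2 * (t.card : ℝ) - s.card) ^ 4 =
      (3 * (s.card : ℝ) ^ 2 - 2 * s.card) * 2 ^ s.card := by
  induction s using Finset.induction_on with
  | empty => simp
  | insert a s ha ih =>
    obtain ⟨h1, h2, h3, h4⟩ := ih
    have h0 : ∑ t ∈ s.powerset, (1 : ℝ) = 2 ^ s.card := by simp
    have hc : ((insert a s).card : ℝ) = s.card + 1 := by
      rw [Finset.card_insert_of_notMem ha]; push_cast; rfl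
    have hp : (2 : ℝ) ^ (insert a s).card = 2 * 2 ^ s.card := by
      rw [Finset.card_insert_of_notMem ha, pow_succ']
    refine ⟨?_, ?_, ?_, ?_⟩
    · rw [sum_powerset_insert_displacement ha fun x => x]
      have : ∀ t ∈ s.powerset, (2 * (t.card : ℝ) - s.card - 1) + (2 * (t.card : ℝ) - s.card + 1) =
          2 * (2 * (t.card : ℝ) - s.card) := fun t _ => by ring
      rw [Finset.sum_congr rfl this, ← Finset.mul_sum, h1, mul_zero]
    · rw [sum_powerset_insert_displacement ha fun x => x ^ 2]
      have : ∀ t ∈ s.powerset,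
          (2 * (t.card : ℝ) - s.card - 1) ^ 2 + (2 * (t.card : ℝ) - s.card + 1) ^ 2 =
          2 * (2 * (t.card : ℝ) - s.card) ^ 2 + 2 * 1 := fun t _ => by ring
      rw [Finset.sum_congr rfl this, Finset.sum_add_distrib, ← Finset.mul_sum, ← Finset.mul_sum,
        h2, h0, hc, hp]
      ring
    · rw [sum_powerset_insert_displacement ha fun x => x ^ 3]
      have : ∀ t ∈ s.powerset,
          (2 * (t.card : ℝ) - s.card - 1) ^ 3 + (2 * (t.card : ℝ) - s.card + 1) ^ 3 =
          2 * (2 * (t.card : ℝ) - s.card) ^ 3 + 6 * (2 * (t.card : ℝ) - s.card) :=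
        fun t _ => by ring
      rw [Finset.sum_congr rfl this, Finset.sum_add_distrib, ← Finset.mul_sum, ← Finset.mul_sum,
        h3, h1]
      ring
    · rw [sum_powerset_insert_displacement ha fun x => x ^ 4]
      have : ∀ t ∈ s.powerset,
          (2 * (t.card : ℝ) - s.card - 1) ^ 4 + (2 * (t.card : ℝ) - s.card + 1) ^ 4 =
          2 * (2 * (t.card : ℝ) - s.card) ^ 4 + 12 * (2 * (t.card : ℝ) - s.card) ^ 2 + 2 * 1 :=
        fun t _ => by ring
      rw [Finset.sum_congr rfl this, Finset.sum_add_distrib, Finset.sum_add_distrib,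
        ← Finset.mul_sum, ← Finset.mul_sum, ← Finset.mul_sum, h4, h2, h0, hc, hp]
      ring

/-- After `64 n²` steps the simple random walk is at height at least `n` with probability at
least `1 / 256`. -/
theorem two_pow_le_card_displacement_ge {α : Type*} [DecidableEq α] (s : Finset α) {n : ℕ}
    (hn : 0 < n) (hs : s.card = 64 * n ^ 2) :
    (2 : ℝ) ^ s.card ≤
      256 * (s.powerset.filter fun t => (n : ℤ) ≤ 2 * (t.card : ℤ) - s.card).card := by
  obtain ⟨h1, h2, h3, h4⟩ := sum_powerset_displacement_pow s
  have h0 : ∑ t ∈ s.powerset, (1 : ℝ) = 2 ^ s.card := by simp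
  have hn0 : (0 : ℝ) < n := by exact_mod_cast hn
  have hsn : (s.card : ℝ) = 64 * (n : ℝ) ^ 2 := by rw [hs]; push_cast; rfl
  set N : ℝ := (n : ℝ) with hN
  have hpoint : ∀ t ∈ s.powerset,
      ((2 * (t.card : ℝ) - s.card) - N) * ((2 * (t.card : ℝ) - s.card) + 16 * N) ^ 2 *
        (16 * N - (2 * (t.card : ℝ) - s.card)) ≤
      64 * (8 * N) ^ 4 * (if (n : ℤ) ≤ 2 * (t.card : ℤ) - s.card then 1 else 0) := by
    intro t _
    have hiff : (n : ℤ) ≤ 2 * (t.card : ℤ) - s.card ↔ N ≤ 2 * (t.card : ℝ) - s.card := by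
      rw [hN]; exact_mod_cast Iff.rfl
    simp only [hiff]
    generalize 2 * (t.card : ℝ) - s.card = x
    split_ifs with h
    · rcases le_total x (16 * N) with h' | h'
      · have e1 : (x - N) ≤ 16 * N := by linarith
        have e2 : (x + 16 * N) ^ 2 ≤ (32 * N) ^ 2 := by
          apply pow_le_pow_left₀ <;> linarith
        have e3 : 16 * N - x ≤ 16 * N := by linarith
        calc (x - N) * (x + 16 * N) ^ 2 * (16 * N - x) ≤ (16 * N) * (32 * N) ^ 2 * (16 * N) := by
              gcongr
          _ = _ := by ring
      · have : (x - N) * (x + 16 * N) ^ 2 * (16 * N - x) ≤ 0 :=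
          mul_nonpos_of_nonneg_of_nonpos (mul_nonneg (by linarith) (sq_nonneg _)) (by linarith)
        exact this.trans (by positivity)
    · rw [mul_zero]
      exact mul_nonpos_of_nonpos_of_nonneg
        (mul_nonpos_of_nonpos_of_nonneg (by linarith) (sq_nonneg _)) (by linarith)
  have hsum := Finset.sum_le_sum hpoint
  rw [← Finset.mul_sum, Finset.sum_boole] at hsum
  have hexp : ∀ t ∈ s.powerset,
      ((2 * (t.card : ℝ) - s.card) - N) * ((2 * (t.card : ℝ) - s.card) + 16 * N) ^ 2 *
        (16 * N - (2 * (t.card : ℝ) - s.card)) =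
      -(2 * (t.card : ℝ) - s.card) ^ 4 - 15 * N * (2 * (t.card : ℝ) - s.card) ^ 3
        + 272 * N ^ 2 * (2 * (t.card : ℝ) - s.card) ^ 2
        + 3840 * N ^ 3 * (2 * (t.card : ℝ) - s.card) - 4096 * N ^ 4 * 1 := fun t _ => by ring
  rw [Finset.sum_congr rfl hexp] at hsum
  simp only [Finset.sum_add_distrib, Finset.sum_sub_distrib, Finset.sum_neg_distrib,
    ← Finset.mul_sum, h1, h2, h3, h4, h0] at hsum
  rw [hsn] at hsum
  have hpos : (0 : ℝ) < 2 ^ s.card := by positivity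
  set Q : ℝ := 2 ^ s.card
  set T : ℝ := ((s.powerset.filter fun t => (n : ℤ) ≤ 2 * (t.card : ℤ) - s.card).card : ℝ)
  have hfin : N ^ 4 * Q ≤ N ^ 4 * (256 * T) := by
    nlinarith [mul_pos (pow_pos hn0 2) hpos, mul_pos (pow_pos hn0 4) hpos]
  exact le_of_mul_le_mul_left hfin (by positivity)

theorem sum_ite_mem_displacement {α : Type*} [DecidableEq α] {s t : Finset α} (h : t ⊆ s) :
    ∑ k ∈ s, (if k ∈ t then (1 : ℤ) else -1) = 2 * t.card - s.card := by
  have : ∀ k ∈ s, (if k ∈ t then (1 : ℤ) else -1) = 2 * (if k ∈ t then 1 else 0) - 1 := by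
    intro k _; split_ifs <;> norm_num
  rw [Finset.sum_congr rfl this, Finset.sum_sub_distrib, ← Finset.mul_sum, Finset.sum_boole,
    Finset.filter_mem_eq_inter, Finset.inter_eq_right.2 h]
  simp

theorem iff_of_ite_eq_ite {p q : Prop} [Decidable p] [Decidable q] {a b : ℤ} (hab : a ≠ b)
    (h : (if p then a else b) = if q then a else b) : p ↔ q := by
  split_ifs at h with hp hq hq
  · exact iff_of_true hp hq
  · exact absurd h hab
  · exact absurd h.symm hab
  · exact iff_of_false hp hq

theorem measurable_walk (a b : ℤ) : Measurable fun ω : ℤ → ℤ => walk ω a b := by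
  unfold walk
  fun_prop

/-- The walk climbs to height `n` on the first half of the block `[s, s + 2m)` and descends by at
least `n` on the second half. -/
def peakEvent (s : ℤ) (m n : ℕ) : Set (ℤ → ℤ) :=
  {ω | (n : ℤ) ≤ walk ω s (s + m) ∧ walk ω (s + m) (s + 2 * m) ≤ -n}

theorem measurableSet_peakEvent (s : ℤ) (m n : ℕ) : MeasurableSet (peakEvent s m n) :=
  (measurableSet_le measurable_const (measurable_walk _ _)).inter
    (measurableSet_le (measurable_walk _ _) measurable_const)

theorem le_measure_peakEvent (P : Measure (ℤ → ℤ)) [IsProbabilityMeasure P]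
    (hiid : ∀ (s : Finset ℤ) (g : ℤ → ℤ), (∀ k ∈ s, g k = 0 ∨ g k = 1) →
      P {ω | ∀ k ∈ s, ω k = g k} = ∏ _k ∈ s, (1 / 2 : ℝ≥0∞))
    (s : ℤ) {n : ℕ} (hn : 0 < n) :
    (1 / 65536 : ℝ) ≤ P.real (peakEvent s (64 * n ^ 2) n) := by
  set m : ℕ := 64 * n ^ 2 with hm
  set s₁ : Finset ℤ := Finset.Ico s (s + m)
  set s₂ : Finset ℤ := Finset.Ico (s + m) (s + 2 * m)
  have hc₁ : s₁.card = m := by simp [s₁]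
  have hc₂ : s₂.card = m := by simp [s₂]; omega
  have hdisj : ∀ k ∈ s₂, k ∉ s₁ := fun k h₂ h₁ => by
    simp only [s₁, s₂, Finset.mem_Ico] at h₁ h₂
    omega
  set T₁ := s₁.powerset.filter fun t => (n : ℤ) ≤ 2 * (t.card : ℤ) - s₁.card with hT₁
  set T₂ := s₂.powerset.filter fun t => (n : ℤ) ≤ 2 * (t.card : ℤ) - s₂.card with hT₂
  have b₁ := two_pow_le_card_displacement_ge s₁ hn hc₁
  have b₂ := two_pow_le_card_displacement_ge s₂ hn hc₂
  rw [← hT₁, hc₁] at b₁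
  rw [← hT₂, hc₂] at b₂
  let g : Finset ℤ × Finset ℤ → ℤ → ℤ := fun p k =>
    if k ∈ s₁ then (if k ∈ p.1 then 0 else 1) else (if k ∈ p.2 then 1 else 0)
  let cyl : Finset ℤ × Finset ℤ → Set (ℤ → ℤ) := fun p => {ω | ∀ k ∈ s₁ ∪ s₂, ω k = g p k}
  have hcyl : ∀ p, P.real (cyl p) = (1 / 2) ^ (m + m) := by
    intro p
    have hg : ∀ k ∈ s₁ ∪ s₂, g p k = 0 ∨ g p k = 1 := by
      intro k _; simp only [g]; split_ifs <;> simp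
    have hcard : (s₁ ∪ s₂).card = m + m := by
      rw [Finset.card_union_of_disjoint (Finset.disjoint_right.2 hdisj), hc₁, hc₂]
    rw [Measure.real, hiid _ _ hg, Finset.prod_const, hcard, ENNReal.toReal_pow]
    simp
  have hmeas : ∀ p, MeasurableSet (cyl p) := by
    intro p
    have : cyl p = ⋂ k ∈ s₁ ∪ s₂, (fun ω : ℤ → ℤ => ω k) ⁻¹' {g p k} := by
      ext ω; simp [cyl]
    rw [this]
    exact Finset.measurableSet_biInter _ fun k _ =>
      measurable_pi_apply k (measurableSet_singleton _)
  have hsub : (⋃ p ∈ T₁ ×ˢ T₂, cyl p) ⊆ peakEvent s m n := by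
    intro ω hω
    simp only [Set.mem_iUnion] at hω
    obtain ⟨⟨t₁, t₂⟩, hp, hω⟩ := hω
    obtain ⟨ht₁, ht₂⟩ := Finset.mem_product.1 hp
    simp only [hT₁, hT₂, Finset.mem_filter, Finset.mem_powerset] at ht₁ ht₂
    constructor
    · have : walk ω s (s + m) = 2 * t₁.card - s₁.card := by
        rw [← sum_ite_mem_displacement ht₁.1, walk]
        refine Finset.sum_congr rfl fun k hk => ?_
        rw [hω k (Finset.mem_union_left _ hk)]
        simp only [g, if_pos (show k ∈ s₁ from hk)]
        split_ifs <;> norm_num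
      rw [this]
      exact ht₁.2
    · have : walk ω (s + m) (s + 2 * m) = -(2 * t₂.card - s₂.card) := by
        rw [← sum_ite_mem_displacement ht₂.1, walk, ← Finset.sum_neg_distrib]
        refine Finset.sum_congr rfl fun k hk => ?_
        rw [hω k (Finset.mem_union_right _ hk)]
        simp only [g, if_neg (hdisj k hk)]
        split_ifs <;> norm_num
      rw [this]
      exact neg_le_neg ht₂.2
  have hpd : Set.PairwiseDisjoint (↑(T₁ ×ˢ T₂)) cyl := by
    rintro ⟨t₁, t₂⟩ hp ⟨t₁', t₂'⟩ hp' hne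
    refine Set.disjoint_left.2 fun ω hω hω' => hne ?_
    obtain ⟨ht₁, ht₂⟩ := Finset.mem_product.1 (Finset.mem_coe.1 hp)
    obtain ⟨ht₁', ht₂'⟩ := Finset.mem_product.1 (Finset.mem_coe.1 hp')
    simp only [hT₁, hT₂, Finset.mem_filter, Finset.mem_powerset] at ht₁ ht₂ ht₁' ht₂'
    have heq : ∀ k ∈ s₁ ∪ s₂, g (t₁, t₂) k = g (t₁', t₂') k := fun k hk =>
      (hω k hk).symm.trans (hω' k hk)
    have e₁ : t₁ = t₁' := by
      ext k
      by_cases hk : k ∈ s₁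
      · have := heq k (Finset.mem_union_left _ hk)
        simp only [g, if_pos hk] at this
        exact iff_of_ite_eq_ite (by norm_num) this
      · exact ⟨fun h => absurd (ht₁.1 h) hk, fun h => absurd (ht₁'.1 h) hk⟩
    have e₂ : t₂ = t₂' := by
      ext k
      by_cases hk : k ∈ s₂
      · have := heq k (Finset.mem_union_right _ hk)
        simp only [g, if_neg (hdisj k hk)] at this
        exact iff_of_ite_eq_ite (by norm_num) this
      · exact ⟨fun h => absurd (ht₂.1 h) hk, fun h => absurd (ht₂'.1 h) hk⟩
    rw [e₁, e₂]
  have hle := measureReal_mono (μ := P) hsub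
  rw [measureReal_biUnion_finset hpd fun p _ => hmeas p, Finset.sum_congr rfl fun p _ => hcyl p,
    Finset.sum_const, Finset.card_product, nsmul_eq_mul, pow_add] at hle
  refine le_trans ?_ hle
  have hhalf : (1 / 2 : ℝ) ^ m * 2 ^ m = 1 := by rw [← mul_pow]; norm_num
  have hpos : (0 : ℝ) < (1 / 2 : ℝ) ^ m := by positivity
  have c₁ : 1 / 256 ≤ (1 / 2 : ℝ) ^ m * T₁.card := by nlinarith
  have c₂ : 1 / 256 ≤ (1 / 2 : ℝ) ^ m * T₂.card := by nlinarith
  calc (1 / 65536 : ℝ) = 1 / 256 * (1 / 256) := by norm_num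
    _ ≤ ((1 / 2 : ℝ) ^ m * T₁.card) * ((1 / 2 : ℝ) ^ m * T₂.card) := by gcongr
    _ = _ := by push_cast; ring

theorem peak_boundary_le {r : ℝ} (hr : 1 < r) {n : ℕ} {A B : ℤ} (hA : (n : ℤ) ≤ A)
    (hB : B ≤ -n) {δ : ℝ} (hδ : 2 * r ^ (-(2 * n : ℤ)) ≤ δ) :
    (r ^ (0 : ℤ)) ^ 2 + (r ^ (A + B)) ^ 2 ≤ δ * (r ^ A) ^ 2 := by
  have hr0 : 0 < r := by linarith
  have hsq : ∀ z : ℤ, (r ^ z) ^ 2 = r ^ (2 * z) := fun z => by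
    rw [← zpow_natCast, ← zpow_mul, mul_comm]; rfl
  have h1 : r ^ (2 * 0 : ℤ) ≤ r ^ (-(2 * n : ℤ)) * r ^ (2 * A) := by
    rw [← zpow_add₀ hr0.ne']
    exact zpow_le_zpow_right₀ hr.le (by omega)
  have h2 : r ^ (2 * (A + B)) ≤ r ^ (-(2 * n : ℤ)) * r ^ (2 * A) := by
    rw [← zpow_add₀ hr0.ne']
    exact zpow_le_zpow_right₀ hr.le (by omega)
  simp only [hsq]
  have := mul_le_mul_of_nonneg_right hδ (zpow_pos hr0 (2 * A)).le
  linarith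

open Classical in
/-- Each peak of the random walk contributes an eigenvalue close to the bottom of the spectrum. -/
theorem card_peakEvent_le_countLE {r lam : ℝ} (hr : 1 < r) (hlam : lam = r - 1 / r) {ω : ℤ → ℤ}
    (hω : ∀ k, ω k = 0 ∨ ω k = 1) {m n J L : ℕ} (hm : 0 < m) (hJ : J * (2 * m + 1) + 1 ≤ L)
    {δ : ℝ} (hδ : 2 * r ^ (-(2 * n : ℤ)) ≤ δ) :
    ((Finset.range J).filter fun j : ℕ => ω ∈ peakEvent (1 + (j : ℤ) * (2 * m + 1)) m n).card ≤
      countLE (dirMat (Finset.Icc 1 (2 * (L : ℤ))) (Vbdm lam ω)) (-1 - 1 / r + δ) := by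
  have hr0 : 0 < r := by linarith
  set R := (Finset.range J).filter fun j : ℕ => ω ∈ peakEvent (1 + (j : ℤ) * (2 * m + 1)) m n with hR
  let s : R → ℤ := fun j => 1 + (j : ℕ) * (2 * m + 1)
  have hs : ∀ j, 1 ≤ s j := fun j => by
    have : (0 : ℤ) ≤ (j : ℕ) * (2 * m + 1) := by positivity
    simp only [s]; omega
  have hJ' : (J : ℤ) * (2 * m + 1) + 1 ≤ L := by exact_mod_cast hJ
  have he : ∀ j, 2 * (s j + 2 * m) ≤ 2 * (L : ℤ) - 1 := fun j => by
    have hj : ((j : ℕ) : ℤ) + 1 ≤ J := by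
      have := Finset.mem_range.1 (Finset.mem_filter.1 j.2).1
      exact_mod_cast this
    have : (((j : ℕ) : ℤ) + 1) * (2 * m + 1) ≤ J * (2 * m + 1) := by gcongr
    simp only [s]
    linarith
  have hsep : ∀ i j, i ≠ j → s i + 2 * m < s j ∨ s j + 2 * m < s i := fun i j hij => by
    have aux : ∀ a b : ℕ, a < b → (1 + (a : ℤ) * (2 * m + 1)) + 2 * m < 1 + b * (2 * m + 1) := by
      intro a b hab
      have hab' : (a : ℤ) + 1 ≤ b := by exact_mod_cast hab
      have : ((a : ℤ) + 1) * (2 * m + 1) ≤ b * (2 * m + 1) := by gcongr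
      linarith
    rcases lt_or_gt_of_ne (fun h => hij (Subtype.ext h) : (i : ℕ) ≠ j) with h | h
    · exact Or.inl (aux _ _ h)
    · exact Or.inr (aux _ _ h)
  let G : R → ℤ → ℝ := fun j k => r ^ walk ω (s j) k
  let v : R → Finset.Icc 1 (2 * (L : ℤ)) → ℝ := fun j i => bump (G j) (s j) (s j + 2 * m) i
  have hnorm : ∀ j, (r ^ walk ω (s j) (s j + m)) ^ 2 ≤ v j ⬝ᵥ v j := fun j =>
    sq_le_bump_dotProduct (G := G j) (hs j) (he j) (by omega) (by omega)
  have hcard := card_le_countLE (dirMat_isHermitian (Finset.Icc 1 (2 * (L : ℤ))) (Vbdm lam ω))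
    (E := -1 - 1 / r + δ) v
    (fun j hj => by
      have h1 := hnorm j
      have h2 : 0 < r ^ walk ω (s j) (s j + m) := zpow_pos hr0 _
      rw [hj, zero_dotProduct] at h1
      nlinarith)
    (fun i j hij => bump_dotProduct_eq_zero (hsep i j hij))
    (fun i j hij => bump_form_eq_zero _ (hs j) (he j) (hsep i j hij))
    (fun j => by
      refine (bump_form_le hr0 hlam hω (hs j) (he j) (G j)
        (isWeight_zpow_walk hr0 hω _ _)).trans ?_
      have hpeak : (n : ℤ) ≤ walk ω (s j) (s j + m) ∧ walk ω (s j + m) (s j + 2 * m) ≤ -n :=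
        (Finset.mem_filter.1 j.2).2
      have hb := peak_boundary_le hr hpeak.1 hpeak.2 hδ
      rw [walk_add ω (by omega) (by omega)] at hb
      have hδ0 : 0 ≤ δ := le_trans (by positivity) hδ
      have hd := mul_le_mul_of_nonneg_left (hnorm j) hδ0
      have e1 : G j (s j) = r ^ (0 : ℤ) := by simp only [G, walk_self]
      rw [e1, add_mul]
      exact add_le_add_right (hb.trans hd) _)
  rwa [Fintype.card_coe] at hcard

theorem measurable_countLE_dirMat_Vbdm (S : Finset ℤ) (lam E : ℝ) :
    Measurable fun ω : ℤ → ℤ => (countLE (dirMat S (Vbdm lam ω)) E : ℝ) := by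
  classical
  let F : (S → Prop) → ℝ := fun b =>
    countLE (dirMat S fun n => if ∃ h : n ∈ S, b ⟨n, h⟩ then lam else 0) E
  have hX : Measurable fun (ω : ℤ → ℤ) (i : S) => ∃ k : ℤ, (i : ℤ) = 2 * k + 1 + ω k := by
    refine measurable_pi_iff.2 fun i => Measurable.exists fun k => ?_
    exact (measurable_from_top (f := fun x : ℤ => (i : ℤ) = 2 * k + 1 + x)).comp
      (measurable_pi_apply k)
  have hF : Measurable F := measurable_of_countable F
  have heq : (fun ω : ℤ → ℤ => (countLE (dirMat S (Vbdm lam ω)) E : ℝ)) =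
      F ∘ fun (ω : ℤ → ℤ) (i : S) => ∃ k : ℤ, (i : ℤ) = 2 * k + 1 + ω k := by
    funext ω
    have : dirMat S (Vbdm lam ω) = dirMat S fun n =>
        if ∃ _ : n ∈ S, ∃ k : ℤ, n = 2 * k + 1 + ω k then lam else 0 := by
      ext i j
      simp [dirMat, Vbdm]
    simp only [F, Function.comp_apply, this]
  rw [heq]
  exact hF.comp hX

theorem integrable_countLE_dirMat_Vbdm (P : Measure (ℤ → ℤ)) [IsProbabilityMeasure P]
    (S : Finset ℤ) (lam E : ℝ) :
    Integrable (fun ω : ℤ → ℤ => (countLE (dirMat S (Vbdm lam ω)) E : ℝ)) P := by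
  refine Integrable.of_bound (measurable_countLE_dirMat_Vbdm S lam E).aestronglyMeasurable
    (S.card : ℝ) (ae_of_all _ fun ω => ?_)
  rw [Real.norm_natCast]
  exact_mod_cast (countLE_le_card _ _).trans (Fintype.card_coe S).le

theorem ae_zero_or_one {P : Measure (ℤ → ℤ)} [IsProbabilityMeasure P]
    (hsupp : P {ω | ∀ k, ω k = 0 ∨ ω k = 1} = 1) : ∀ᵐ ω ∂P, ∀ k, ω k = 0 ∨ ω k = 1 := by
  have hmeas : MeasurableSet {ω : ℤ → ℤ | ∀ k, ω k = 0 ∨ ω k = 1} := by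
    have : {ω : ℤ → ℤ | ∀ k, ω k = 0 ∨ ω k = 1} =
        ⋂ k, (fun ω : ℤ → ℤ => ω k) ⁻¹' {x | x = 0 ∨ x = 1} := by
      ext ω; simp
    rw [this]
    exact MeasurableSet.iInter fun k => measurable_pi_apply k (MeasurableSet.of_discrete)
  exact (mem_ae_iff_prob_eq_one hmeas).2 hsupp

theorem mul_le_integral_countLE {r lam : ℝ} (hr : 1 < r) (hlam : lam = r - 1 / r)
    (P : Measure (ℤ → ℤ)) [IsProbabilityMeasure P]
    (hsupp : P {ω | ∀ k, ω k = 0 ∨ ω k = 1} = 1)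
    (hiid : ∀ (s : Finset ℤ) (g : ℤ → ℤ), (∀ k ∈ s, g k = 0 ∨ g k = 1) →
      P {ω | ∀ k ∈ s, ω k = g k} = ∏ _k ∈ s, (1 / 2 : ℝ≥0∞))
    {n J L : ℕ} (hn : 0 < n) (hJ : J * (2 * (64 * n ^ 2) + 1) + 1 ≤ L)
    {δ : ℝ} (hδ : 2 * r ^ (-(2 * n : ℤ)) ≤ δ) :
    (J : ℝ) * (1 / 65536) ≤
      ∫ ω, (countLE (dirMat (Finset.Icc 1 (2 * (L : ℤ))) (Vbdm lam ω)) (-1 - 1 / r + δ) : ℝ) ∂P := by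
  classical
  let B : ℕ → Set (ℤ → ℤ) := fun j =>
    peakEvent (1 + j * (2 * (64 * n ^ 2 : ℕ) + 1)) (64 * n ^ 2) n
  have hB : ∀ j, MeasurableSet (B j) := fun j => measurableSet_peakEvent _ _ _
  have hint : ∀ j ∈ Finset.range J, Integrable ((B j).indicator (fun _ => (1 : ℝ))) P :=
    fun j _ => (integrable_const 1).indicator (hB j)
  calc (J : ℝ) * (1 / 65536) = ∑ j ∈ Finset.range J, (1 / 65536 : ℝ) := by simp
    _ ≤ ∑ j ∈ Finset.range J, P.real (B j) :=
        Finset.sum_le_sum fun j _ => le_measure_peakEvent P hiid _ hn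
    _ = ∑ j ∈ Finset.range J, ∫ ω, (B j).indicator (fun _ => (1 : ℝ)) ω ∂P :=
        Finset.sum_congr rfl fun j _ => (integral_indicator_one (hB j)).symm
    _ = ∫ ω, ∑ j ∈ Finset.range J, (B j).indicator (fun _ => (1 : ℝ)) ω ∂P :=
        (integral_finsetSum _ hint).symm
    _ ≤ _ := by
        refine integral_mono_ae (integrable_finsetSum _ hint)
          (integrable_countLE_dirMat_Vbdm P _ lam _) ?_
        filter_upwards [ae_zero_or_one hsupp] with ω hω
        have h := card_peakEvent_le_countLE hr hlam hω (by positivity : 0 < 64 * n ^ 2) hJ hδ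
        simp only [Set.indicator_apply, Finset.sum_boole]
        exact Nat.cast_le.2 h

theorem le_liminf_countLE {r lam : ℝ} (hr : 1 < r) (hlam : lam = r - 1 / r)
    (P : Measure (ℤ → ℤ)) [IsProbabilityMeasure P]
    (hsupp : P {ω | ∀ k, ω k = 0 ∨ ω k = 1} = 1)
    (hiid : ∀ (s : Finset ℤ) (g : ℤ → ℤ), (∀ k ∈ s, g k = 0 ∨ g k = 1) →
      P {ω | ∀ k ∈ s, ω k = g k} = ∏ _k ∈ s, (1 / 2 : ℝ≥0∞))
    {n : ℕ} (hn : 0 < n) {δ : ℝ} (hδ : 2 * r ^ (-(2 * n : ℤ)) ≤ δ) :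
    1 / (50331648 * (n : ℝ) ^ 2) ≤ liminf (fun L : ℕ => (1 / (2 * (L : ℝ))) *
      ∫ ω, (countLE (dirMat (Finset.Icc 1 (2 * (L : ℤ))) (Vbdm lam ω)) (-1 - 1 / r + δ) : ℝ) ∂P)
      atTop := by
  have hbdd : ∀ L : ℕ, (1 / (2 * (L : ℝ))) * ∫ ω, (countLE (dirMat (Finset.Icc 1 (2 * (L : ℤ)))
      (Vbdm lam ω)) (-1 - 1 / r + δ) : ℝ) ∂P ≤ 1 := by
    intro L
    have hle : ∫ ω, (countLE (dirMat (Finset.Icc 1 (2 * (L : ℤ)))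
        (Vbdm lam ω)) (-1 - 1 / r + δ) : ℝ) ∂P ≤ ∫ _, 2 * (L : ℝ) ∂P := by
      refine integral_mono (integrable_countLE_dirMat_Vbdm P _ lam _) (integrable_const _)
        fun ω => ?_
      have h := countLE_le_card (dirMat (Finset.Icc 1 (2 * (L : ℤ))) (Vbdm lam ω))
        (-1 - 1 / r + δ)
      have hc : Fintype.card (Finset.Icc 1 (2 * (L : ℤ))) = 2 * L := by
        rw [Fintype.card_coe, Int.card_Icc]; omega
      rw [hc] at h
      exact (Nat.cast_le.2 h).trans (by push_cast; exact le_rfl)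
    rw [integral_const, probReal_univ, one_smul] at hle
    calc _ ≤ (1 / (2 * (L : ℝ))) * (2 * (L : ℝ)) := by gcongr
      _ ≤ 1 := by
        rw [one_div]
        exact inv_mul_le_one
  refine le_liminf_of_le (isBoundedUnder_of ⟨1, hbdd⟩).isCoboundedUnder_ge ?_
  filter_upwards [eventually_ge_atTop (4 * (64 * n ^ 2) + 2)] with L hL
  set M := 2 * (64 * n ^ 2) + 1 with hM
  have hdiv : (L - 1) / M * M ≤ L - 1 := Nat.div_mul_le_self _ _
  have hlt : L - 1 < ((L - 1) / M + 1) * M := 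
    (Nat.div_lt_iff_lt_mul (by omega)).1 (Nat.lt_succ_self _)
  set J := (L - 1) / M
  have hlow := mul_le_integral_countLE hr hlam P hsupp hiid hn
    (by rw [← hM]; omega : J * (2 * (64 * n ^ 2) + 1) + 1 ≤ L) hδ
  have hnat : L ≤ J * (384 * n ^ 2) := by
    have h1 : L ≤ 2 * (J * M) := by
      have : (J + 1) * M = J * M + M := by ring
      omega
    have h2 : 2 * M ≤ 384 * n ^ 2 := by
      have : 0 < n ^ 2 := by positivity
      omega
    calc L ≤ J * (2 * M) := by rw [mul_left_comm]; exact h1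
      _ ≤ _ := Nat.mul_le_mul_left _ h2
  have hreal : (L : ℝ) ≤ J * (384 * (n : ℝ) ^ 2) := by exact_mod_cast hnat
  have hL0 : (0 : ℝ) < L := by
    have : 0 < L := by omega
    exact_mod_cast this
  have hn0 : (0 : ℝ) < n := by exact_mod_cast hn
  calc 1 / (50331648 * (n : ℝ) ^ 2) ≤ (1 / (2 * (L : ℝ))) * (J * (1 / 65536)) := by
        rw [div_mul_eq_mul_div, one_mul, div_le_div_iff₀ (by positivity) (by positivity)]
        linarith
    _ ≤ _ := by gcongr

/-- The bottom of the spectrum in terms of the growth factor `r > 1` with `r - 1 / r = λ`. -/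
theorem exists_growth_factor {lam : ℝ} (hlam : 0 < lam) :
    ∃ r : ℝ, 1 < r ∧ lam = r - 1 / r ∧
      lam / 2 - Real.sqrt (2 + lam ^ 2 / 4 + Real.sqrt (4 + lam ^ 2)) = -1 - 1 / r := by
  set q := Real.sqrt (1 + lam ^ 2 / 4) with hq
  have hq2 : q ^ 2 = 1 + lam ^ 2 / 4 := Real.sq_sqrt (by positivity)
  have hq0 : 0 ≤ q := Real.sqrt_nonneg _
  have hq1 : 1 ≤ q := by nlinarith
  have hinv : 1 / (lam / 2 + q) = q - lam / 2 := by
    rw [div_eq_iff (by positivity)]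
    linear_combination -hq2
  have h1 : Real.sqrt (4 + lam ^ 2) = 2 * q := by
    rw [Real.sqrt_eq_iff_mul_self_eq (by positivity) (by positivity)]
    linear_combination (-4) * hq2
  have h2 : Real.sqrt (2 + lam ^ 2 / 4 + 2 * q) = 1 + q := by
    rw [Real.sqrt_eq_iff_mul_self_eq (by positivity) (by positivity)]
    linear_combination -hq2
  refine ⟨lam / 2 + q, by linarith, ?_, ?_⟩
  · rw [hinv]; ring
  · rw [hinv, h1, h2]; ring

/-- **`1/log²` lower bound for the integrated density of states at the bottom of the
spectrum** of the symmetric Bernoulli displacement model, `λ > 0`:  with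
`E₋ = λ/2 − √(2 + λ²/4 + √(4+λ²))`, there are `C, ε > 0` such that for all
`E ∈ (E₋, E₋ + ε)`,
`liminf_{L→∞} (2L)⁻¹ 𝔼[#{k : E_k(h^D_{Λ(L)}(ω)) ≤ E}] ≥ C / log²(E − E₋)`.
In particular `N_λ(E) − N_λ(E₋) ≥ C / log²(E − E₋)`, so the IDS is not Hölder
continuous at `E₋`. -/
theorem bdm_ids_log_squared_lower_bound
    (lam : ℝ) (hlam : 0 < lam)
    (P : Measure (ℤ → ℤ)) [IsProbabilityMeasure P]
    (hsupp : P {ω | ∀ k, ω k = 0 ∨ ω k = 1} = 1)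
    (hiid : ∀ (s : Finset ℤ) (g : ℤ → ℤ), (∀ k ∈ s, g k = 0 ∨ g k = 1) →
      P {ω | ∀ k ∈ s, ω k = g k} = ∏ _k ∈ s, (1 / 2 : ℝ≥0∞)) :
    ∃ C > (0 : ℝ), ∃ ε > (0 : ℝ), ∀ E : ℝ,
      lam / 2 - Real.sqrt (2 + lam ^ 2 / 4 + Real.sqrt (4 + lam ^ 2)) < E →
      E < lam / 2 - Real.sqrt (2 + lam ^ 2 / 4 + Real.sqrt (4 + lam ^ 2)) + ε →
      C / (Real.log (E - (lam / 2
          - Real.sqrt (2 + lam ^ 2 / 4 + Real.sqrt (4 + lam ^ 2))))) ^ 2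
        ≤ liminf (fun L : ℕ =>
            (1 / (2 * (L : ℝ))) *
              ∫ ω, (countLE (dirMat (Finset.Icc 1 (2 * (L : ℤ))) (Vbdm lam ω)) E : ℝ) ∂P)
          atTop := by
  obtain ⟨r, hr, hlr, hE⟩ := exists_growth_factor hlam
  rw [hE]
  have hlog : 0 < Real.log r := Real.log_pos hr
  have hr0 : 0 < r := by linarith
  set K := 1 / Real.log r + 1 with hK
  have hK0 : 0 < K := by positivity
  refine ⟨1 / (50331648 * K ^ 2), by positivity, Real.exp (-1), Real.exp_pos _, fun E h1 h2 => ?_⟩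
  obtain ⟨δ, rfl⟩ : ∃ δ, E = -1 - 1 / r + δ := ⟨E - (-1 - 1 / r), by ring⟩
  have hδ0 : 0 < δ := by linarith
  have hδ1 : δ < Real.exp (-1) := by linarith
  have hsub : -1 - 1 / r + δ - (-1 - 1 / r) = δ := by ring
  rw [hsub]
  set ℓ := -Real.log δ with hℓ
  have hℓ1 : 1 < ℓ := by
    have := (Real.log_lt_iff_lt_exp hδ0).2 hδ1
    linarith
  set n := ⌈ℓ / Real.log r⌉₊ with hn
  have hn0 : 0 < n := Nat.ceil_pos.2 (by positivity)
  have hn0' : (0 : ℝ) < n := by exact_mod_cast hn0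
  have hnl : ℓ ≤ n * Real.log r := (div_le_iff₀ hlog).1 (Nat.le_ceil _)
  have hnu : (n : ℝ) ≤ K * ℓ := by
    have := Nat.ceil_lt_add_one (show 0 ≤ ℓ / Real.log r by positivity)
    calc (n : ℝ) ≤ ℓ / Real.log r + 1 := this.le
      _ ≤ ℓ / Real.log r + ℓ := by linarith
      _ = K * ℓ := by rw [hK]; ring
  have hδn : 2 * r ^ (-(2 * n : ℤ)) ≤ δ := by
    have hpos : 0 < 2 * r ^ (-(2 * n : ℤ)) := by positivity
    rw [← Real.log_le_log_iff hpos hδ0, Real.log_mul (by norm_num) (by positivity),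
      Real.log_zpow]
    have h2l := Real.log_two_lt_d9
    push_cast
    linarith
  refine le_trans ?_ (le_liminf_countLE hr hlr P hsupp hiid hn0 hδn)
  have hsq : Real.log δ ^ 2 = ℓ ^ 2 := by rw [hℓ]; ring
  rw [hsq, div_div]
  apply one_div_le_one_div_of_le (by positivity)
  calc 50331648 * (n : ℝ) ^ 2 ≤ 50331648 * (K * ℓ) ^ 2 := by gcongr
    _ = 50331648 * K ^ 2 * ℓ ^ 2 := by ring
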